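/- For every integer i ≥ 1, the rational number b_{(i,4,1)} equals (i³ − 5i²)/(24(i+1)(i+2)(i+3)(i+4)), which moreover equals (1/4!)·(−1/(i+1) + 14/(i+2) − 36/(i+3) + 24/(i+4)). -/

import Mathlib

open Finset

/-- `b i j k` from the paper, defined for `i ≥ 1` (we set `b 0 _ _ = 0`):
`b 1 j 0 = -1/j!`, `b 1 j k = (-1)^(j+1-k) * B_(j+1-k) / (j+1-k)!` for `k ≥ 1`, and for `i ≥ 2`,
`b i j k = ∑_{m=0}^{min(j, i+j-k)} ((-1)^m B_m / m!) * b (i-1) (j+1-m) k - (if k = 0 then 1/j! else 0)`.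
Here `bernoulli` is Mathlib's Bernoulli number, with EGF `t/(e^t - 1)` (so `bernoulli 1 = -1/2`). -/
def b : ℕ → ℕ → ℕ → ℚ
  | 0, _, _ => 0
  | 1, j, k =>
      if k = 0 then -(1 / (Nat.factorial j : ℚ))
      else (-1) ^ (j + 1 - k) * bernoulli (j + 1 - k) / (Nat.factorial (j + 1 - k) : ℚ)
  | (i + 2), j, k =>
      (∑ m ∈ Finset.range (min j (i + 2 + j - k) + 1),
        ((-1) ^ m * bernoulli m / (Nat.factorial m : ℚ)) * b (i + 1) (j + 1 - m) k)
      - (if k = 0 then 1 / (Nat.factorial j : ℚ) else 0)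

open PowerSeries in
/-- The power series `1 - e^(-X)`. -/
noncomputable def oneSubExpNeg : PowerSeries ℚ := 1 - evalNegHom (exp ℚ)

open PowerSeries in
/-- The power series `X / (1 - e^(-X))`. -/
noncomputable def toddSeries : PowerSeries ℚ := evalNegHom (bernoulliPowerSeries ℚ)

open PowerSeries in
theorem coeff_oneSubExpNeg (n : ℕ) :
    coeff n oneSubExpNeg = (if n = 0 then 1 else 0) - (-1) ^ n / (n.factorial : ℚ) := by
  simp [oneSubExpNeg, evalNegHom, coeff_rescale, coeff_exp, coeff_one, div_eq_mul_inv]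

open PowerSeries in
theorem coeff_toddSeries (n : ℕ) :
    coeff n toddSeries = (-1) ^ n * bernoulli n / (n.factorial : ℚ) := by
  simp [toddSeries, evalNegHom, coeff_rescale, bernoulliPowerSeries, mul_div_assoc]

open PowerSeries in
theorem toddSeries_mul_oneSubExpNeg : toddSeries * oneSubExpNeg = X := by
  have h := congrArg evalNegHom (bernoulliPowerSeries_mul_exp_sub_one ℚ)
  rw [map_mul, map_sub, map_one, evalNegHom_X] at h
  unfold toddSeries oneSubExpNeg
  linear_combination -h

open PowerSeries in
theorem X_dvd_oneSubExpNeg : (X : PowerSeries ℚ) ∣ oneSubExpNeg := by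
  rw [X_dvd_iff, ← coeff_zero_eq_constantCoeff_apply, coeff_oneSubExpNeg]
  simp

open PowerSeries in
theorem coeff_oneSubExpNeg_pow_of_lt {j n : ℕ} (h : j < n) : coeff j (oneSubExpNeg ^ n) = 0 :=
  X_pow_dvd_iff.mp (pow_dvd_pow_of_dvd X_dvd_oneSubExpNeg n) j h

open PowerSeries in
theorem derivative_oneSubExpNeg : d⁄dX ℚ oneSubExpNeg = 1 - oneSubExpNeg := by
  ext n
  rw [coeff_derivative, map_sub, coeff_oneSubExpNeg, coeff_oneSubExpNeg, coeff_one,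
    Nat.factorial_succ]
  have : (n.factorial : ℚ) ≠ 0 := by positivity
  have : (n : ℚ) + 1 ≠ 0 := by positivity
  push_cast
  field_simp
  ring

open PowerSeries in
/-- The truncated expansion `∑_{n < N} u^(n+1)/(n+1+i)` in powers of `u = 1 - e^(-X)`. -/
noncomputable def truncatedLog (N i : ℕ) : PowerSeries ℚ :=
  ∑ n ∈ Finset.range N, (1 / ((n : ℚ) + 1 + i)) • oneSubExpNeg ^ (n + 1)

open PowerSeries in
theorem derivative_truncatedLog_zero (N : ℕ) :
    d⁄dX ℚ (truncatedLog N 0) = 1 - oneSubExpNeg ^ N := by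
  induction N with
  | zero => simp [truncatedLog]
  | succ N ih =>
    unfold truncatedLog at ih ⊢
    have : (N : ℚ) + 1 ≠ 0 := by positivity
    rw [Finset.sum_range_succ, map_add, ih, Derivation.map_smul, derivative_pow,
      derivative_oneSubExpNeg, smul_eq_C_mul]
    have hC : (C (1 / ((N : ℚ) + 1 + (0 : ℕ)))) * ((N + 1 : ℕ) : PowerSeries ℚ) = 1 := by
      rw [← map_natCast (C (R := ℚ)), ← map_mul, ← map_one (C (R := ℚ))]
      congr 1
      push_cast
      field_simp
      simp
    rw [Nat.add_sub_cancel]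
    linear_combination (oneSubExpNeg ^ N * (1 - oneSubExpNeg)) * hC

open PowerSeries in
theorem coeff_zero_truncatedLog (N i : ℕ) : coeff 0 (truncatedLog N i) = 0 := by
  rw [truncatedLog, map_sum]
  refine Finset.sum_eq_zero fun n _ => ?_
  rw [map_smul, coeff_oneSubExpNeg_pow_of_lt (Nat.succ_pos n), smul_zero]

open PowerSeries in
theorem coeff_truncatedLog_zero {N j : ℕ} (h : j ≤ N) :
    coeff j (truncatedLog N 0) = coeff j (X : PowerSeries ℚ) := by
  cases j with
  | zero => rw [coeff_zero_truncatedLog]; simp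
  | succ j =>
    have hd := congrArg (coeff j) (derivative_truncatedLog_zero N)
    rw [coeff_derivative, map_sub, coeff_oneSubExpNeg_pow_of_lt (by omega), coeff_one] at hd
    have : (j : ℚ) + 1 ≠ 0 := by positivity
    rw [coeff_X]
    rcases Nat.eq_zero_or_pos j with rfl | hj
    · simpa using hd
    · simpa [hj.ne', this] using hd

open PowerSeries in
theorem coeff_toddSeries_mul_truncatedLog {M i j : ℕ} (hj : 1 ≤ j) :
    coeff (j + 1) (toddSeries * truncatedLog (M + 1) i) = coeff j (truncatedLog M (i + 1)) := by
  have h : toddSeries * truncatedLog (M + 1) i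
      = X * ((1 / (1 + (i : ℚ))) • 1 + truncatedLog M (i + 1)) := by
    unfold truncatedLog
    rw [Finset.mul_sum, Finset.sum_range_succ', add_comm, mul_add, Finset.mul_sum]
    congr 1
    · rw [mul_smul_comm, mul_smul_comm]
      simp [toddSeries_mul_oneSubExpNeg]
    · refine Finset.sum_congr rfl fun n _ => ?_
      rw [mul_smul_comm, mul_smul_comm, pow_succ' _ (n + 1), ← mul_assoc,
        toddSeries_mul_oneSubExpNeg]
      congr 1
      push_cast
      ring
  rw [h, coeff_succ_X_mul, map_add, map_smul, coeff_one, if_neg (by omega), smul_zero, zero_add]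

open PowerSeries in
theorem coeff_truncatedLog_one {N j : ℕ} (hj : 1 ≤ j) (h : j ≤ N) :
    coeff j (truncatedLog N 1) = coeff j toddSeries := by
  rw [← coeff_toddSeries_mul_truncatedLog (i := 0) hj, ← coeff_succ_mul_X j toddSeries,
    coeff_mul, coeff_mul]
  refine Finset.sum_congr rfl fun p hp => ?_
  rw [Finset.HasAntidiagonal.mem_antidiagonal] at hp
  rw [coeff_truncatedLog_zero (by omega)]

open PowerSeries in
theorem b_one_eq_coeff_truncatedLog (i : ℕ) :
    ∀ {N j : ℕ}, 1 ≤ j → j ≤ N → b (i + 1) j 1 = coeff j (truncatedLog N (i + 1)) := by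
  induction i with
  | zero =>
    intro N j hj h
    rw [coeff_truncatedLog_one hj h, coeff_toddSeries]
    simp [b]
  | succ i ih =>
    intro N j hj h
    rw [← coeff_toddSeries_mul_truncatedLog hj, coeff_mul,
      Finset.Nat.sum_antidiagonal_eq_sum_range_succ_mk, Finset.sum_range_succ, Nat.sub_self,
      coeff_zero_truncatedLog, mul_zero, add_zero, b, if_neg one_ne_zero, sub_zero,
      min_eq_left (by omega)]
    refine Finset.sum_congr rfl fun m hm => ?_
    rw [Finset.mem_range] at hm
    rw [ih (by omega) (by omega : j + 1 - m ≤ N + 1), coeff_toddSeries]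

open PowerSeries in
theorem coeff_four_truncatedLog (i : ℕ) :
    coeff 4 (truncatedLog 4 i) = (1 / (Nat.factorial 4 : ℚ)) *
      (-1 / ((i : ℚ) + 1) + 14 / ((i : ℚ) + 2) - 36 / ((i : ℚ) + 3) + 24 / ((i : ℚ) + 4)) := by
  simp [truncatedLog, Finset.sum_range_succ, pow_succ, coeff_mul, coeff_oneSubExpNeg,
    Finset.Nat.antidiagonal_succ, Nat.factorial]
  have h1 : (i : ℚ) + 1 ≠ 0 := by positivity
  have h2 : (i : ℚ) + 2 ≠ 0 := by positivity
  have h3 : (i : ℚ) + 3 ≠ 0 := by positivity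
  have h4 : (i : ℚ) + 4 ≠ 0 := by positivity
  rw [show (1 : ℚ) + i = i + 1 by ring, show (1 : ℚ) + 1 + i = i + 2 by ring,
    show (2 : ℚ) + 1 + i = i + 3 by ring, show (3 : ℚ) + 1 + i = i + 4 by ring]
  field_simp
  ring

/-- For every integer `i ≥ 1`,
`b i 4 1 = (i³ - 5i²)/(24(i+1)(i+2)(i+3)(i+4))`, which moreover equals
`(1/4!) * (-1/(i+1) + 14/(i+2) - 36/(i+3) + 24/(i+4))`. -/
theorem b_four_one (i : ℕ) (hi : 1 ≤ i) :
    b i 4 1 = ((i : ℚ) ^ 3 - 5 * (i : ℚ) ^ 2) /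
        (24 * ((i : ℚ) + 1) * ((i : ℚ) + 2) * ((i : ℚ) + 3) * ((i : ℚ) + 4)) ∧
    ((i : ℚ) ^ 3 - 5 * (i : ℚ) ^ 2) /
        (24 * ((i : ℚ) + 1) * ((i : ℚ) + 2) * ((i : ℚ) + 3) * ((i : ℚ) + 4))
      = (1 / (Nat.factorial 4 : ℚ)) *
        (-1 / ((i : ℚ) + 1) + 14 / ((i : ℚ) + 2) - 36 / ((i : ℚ) + 3) + 24 / ((i : ℚ) + 4)) := by
  have hfrac : ((i : ℚ) ^ 3 - 5 * (i : ℚ) ^ 2) /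
        (24 * ((i : ℚ) + 1) * ((i : ℚ) + 2) * ((i : ℚ) + 3) * ((i : ℚ) + 4))
      = (1 / (Nat.factorial 4 : ℚ)) *
        (-1 / ((i : ℚ) + 1) + 14 / ((i : ℚ) + 2) - 36 / ((i : ℚ) + 3) + 24 / ((i : ℚ) + 4)) := by
    have h1 : (i : ℚ) + 1 ≠ 0 := by positivity
    have h2 : (i : ℚ) + 2 ≠ 0 := by positivity
    have h3 : (i : ℚ) + 3 ≠ 0 := by positivity
    have h4 : (i : ℚ) + 4 ≠ 0 := by positivity
    rw [show (Nat.factorial 4 : ℚ) = 24 by norm_num [Nat.factorial]]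
    field_simp
    ring
  refine ⟨?_, hfrac⟩
  obtain ⟨k, rfl⟩ := Nat.exists_eq_add_of_le' hi
  rw [hfrac, b_one_eq_coeff_truncatedLog k (by omega) le_rfl, coeff_four_truncatedLog]
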